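/- Let R > 0 be such that for all i and all x ∈ B(Γ,R) ∩ Pᵢ, B(0, δ/2) ∩ (ℝe₀ + ℝeᵢ) ⊆ Fᵢ(x). Then for any bounded viscosity subsolution u of the Hamilton–Jacobi equation there exists a constant C* > 0 such that for every x ∈ B(Γ,R) ∩ S and every admissible test function φ ∈ R(S) such that u − φ has a local maximum at x, one has: |D(φ|_{Pᵢ})(x)| ≤ C* if x ∈ (B(Γ,R) ∩ Pᵢ)∖Γ, and max_{i=1,…,N}(|∂_{x₀}φ(x)| + max(0, −∂_{xᵢ}(φ|_{Pᵢ})(x))) ≤ C* if x ∈ Γ. -/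

import Mathlib

open scoped RealInnerProductSpace
open Set Metric MeasureTheory

noncomputable section

abbrev E3 : Type := EuclideanSpace ℝ (Fin 3)

/-- The closed half-plane `ℝ e0 × ℝ₊ ei`. -/
def halfPlane (e0 ei : E3) : Set E3 :=
  {x | ∃ x0 xi : ℝ, 0 ≤ xi ∧ x = x0 • e0 + xi • ei}

/-- The interface `Γ = ℝ e0`. -/
def iface (e0 : E3) : Set E3 := {x | ∃ t : ℝ, x = t • e0}

/-- The junction `S = ⋃ i Pᵢ`. -/
def junction (N : ℕ) (e0 : E3) (e : Fin N → E3) : Set E3 :=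
  ⋃ i, halfPlane e0 (e i)

/-- Admissible test functions on the junction: continuous on `S`, `C¹` on each
half-plane `Pᵢ`, with `Dφ i x ∈ ℝ e0 + ℝ eᵢ` the gradient of `φ|_{Pᵢ}`. -/
structure TestFun (N : ℕ) (e0 : E3) (e : Fin N → E3) where
  φ : E3 → ℝ
  Dφ : Fin N → E3 → E3
  cont : ContinuousOn φ (junction N e0 e)
  dphi_plane : ∀ i, ∀ x ∈ halfPlane e0 (e i), ∃ c0 ci : ℝ, Dφ i x = c0 • e0 + ci • e i
  hasDeriv : ∀ i, ∀ x ∈ halfPlane e0 (e i),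
    HasFDerivWithinAt φ (innerSL ℝ (Dφ i x)) (halfPlane e0 (e i)) x
  contDeriv : ∀ i, ContinuousOn (Dφ i) (halfPlane e0 (e i))

/-- Viscosity subsolution of `λ u(x) + sup_{(ζ,ξ) ∈ FL(x)} {-Du(x,ζ) - ξ} = 0` on `S`,
where `FL(x) = FLᵢ(x)` if `x ∈ Pᵢ \ Γ` and `FL(x) = ⋃ᵢ FLᵢ⁺(x)` if `x ∈ Γ`. -/
def IsSubSol (N : ℕ) (e0 : E3) (e : Fin N → E3) {A : Type} [MetricSpace A]
    (Ai : Fin N → Set A) (f : Fin N → E3 → A → E3) (ℓ : Fin N → E3 → A → ℝ)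
    (lam : ℝ) (u : E3 → ℝ) : Prop :=
  ∀ x ∈ junction N e0 e, ∀ ψ : TestFun N e0 e,
    IsLocalMaxOn (fun y => u y - ψ.φ y) (junction N e0 e) x →
    ∀ i, x ∈ halfPlane e0 (e i) → ∀ a ∈ Ai i,
      (x ∉ iface e0 ∨ 0 ≤ ⟪f i x a, e i⟫) →
      lam * u x - ⟪ψ.Dφ i x, f i x a⟫ - ℓ i x a ≤ 0

/-- Viscosity supersolution of the same Hamilton-Jacobi equation on `S`. -/
def IsSuperSol (N : ℕ) (e0 : E3) (e : Fin N → E3) {A : Type} [MetricSpace A]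
    (Ai : Fin N → Set A) (f : Fin N → E3 → A → E3) (ℓ : Fin N → E3 → A → ℝ)
    (lam : ℝ) (v : E3 → ℝ) : Prop :=
  ∀ x ∈ junction N e0 e, ∀ ψ : TestFun N e0 e,
    IsLocalMinOn (fun y => v y - ψ.φ y) (junction N e0 e) x →
    ∃ i, x ∈ halfPlane e0 (e i) ∧ ∃ a ∈ Ai i,
      (x ∉ iface e0 ∨ 0 ≤ ⟪f i x a, e i⟫) ∧
      0 ≤ lam * v x - ⟪ψ.Dφ i x, f i x a⟫ - ℓ i x a

/-- Gradient bound for bounded viscosity subsolutions near the interface, under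
full controllability. -/
theorem stmt_16
    (N : ℕ) (hN : 2 ≤ N) (e0 : E3) (e : Fin N → E3)
    (he0 : ‖e0‖ = 1) (he : ∀ k, ‖e k‖ = 1)
    (heinj : Function.Injective e) (hee0 : ∀ k, e k ≠ e0)
    (horth : ∀ k, ⟪e k, e0⟫ = 0)
    {A : Type} [MetricSpace A] (Ai : Fin N → Set A)
    (hAne : ∀ k, (Ai k).Nonempty) (hAcp : ∀ k, IsCompact (Ai k))
    (hAdisj : ∀ k l, k ≠ l → Disjoint (Ai k) (Ai l))
    (f : Fin N → E3 → A → E3) (Mf Lf : ℝ)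
    (hfcont : ∀ k, ContinuousOn (fun q : E3 × A => f k q.1 q.2)
      ((halfPlane e0 (e k)) ×ˢ (Ai k)))
    (hfplane : ∀ k, ∀ x ∈ halfPlane e0 (e k), ∀ a ∈ Ai k,
      ∃ c0 ci : ℝ, f k x a = c0 • e0 + ci • e k)
    (hfbdd : ∀ k, ∀ x ∈ halfPlane e0 (e k), ∀ a ∈ Ai k, ‖f k x a‖ ≤ Mf)
    (hflip : ∀ k, ∀ x ∈ halfPlane e0 (e k), ∀ y ∈ halfPlane e0 (e k), ∀ a ∈ Ai k,
      ‖f k x a - f k y a‖ ≤ Lf * ‖x - y‖)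
    (ℓ : Fin N → E3 → A → ℝ) (Mℓ : ℝ) (ω : ℝ → ℝ)
    (hωmono : Monotone ω) (hω0 : ω 0 = 0)
    (hlcont : ∀ k, ContinuousOn (fun q : E3 × A => ℓ k q.1 q.2)
      ((halfPlane e0 (e k)) ×ˢ (Ai k)))
    (hlbdd : ∀ k, ∀ x ∈ halfPlane e0 (e k), ∀ a ∈ Ai k, |ℓ k x a| ≤ Mℓ)
    (hlmod : ∀ k, ∀ x ∈ halfPlane e0 (e k), ∀ y ∈ halfPlane e0 (e k), ∀ a ∈ Ai k,
      |ℓ k x a - ℓ k y a| ≤ ω ‖x - y‖)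
    (hH2 : ∀ k, ∀ x ∈ halfPlane e0 (e k),
      Convex ℝ {q : E3 × ℝ | ∃ a ∈ Ai k, q = (f k x a, ℓ k x a)})
    (δ : ℝ) (hδ : 0 < δ)
    (hH3 : ∀ k, ∀ x ∈ iface e0, ∀ w : E3, ‖w‖ < δ →
      (∃ c0 ci : ℝ, w = c0 • e0 + ci • e k) → ∃ a ∈ Ai k, f k x a = w)
    (R : ℝ) (hR : 0 < R)
    (hRctrl : ∀ k : Fin N, ∀ x ∈ halfPlane e0 (e k), Metric.infDist x (iface e0) < R →
      ∀ w : E3, ‖w‖ < δ / 2 → (∃ c0 ci : ℝ, w = c0 • e0 + ci • e k) →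
        ∃ a ∈ Ai k, f k x a = w)
    (lam : ℝ) (hlam : 0 < lam)
    (u : E3 → ℝ) (husc : UpperSemicontinuousOn u (junction N e0 e))
    (Mu : ℝ) (hMu : ∀ x ∈ junction N e0 e, |u x| ≤ Mu)
    (hu : IsSubSol N e0 e Ai f ℓ lam u) :
    ∃ Cs : ℝ, 0 < Cs ∧ ∀ x ∈ junction N e0 e, Metric.infDist x (iface e0) < R →
      ∀ ψ : TestFun N e0 e,
        IsLocalMaxOn (fun y => u y - ψ.φ y) (junction N e0 e) x →
        (∀ i, x ∈ halfPlane e0 (e i) → x ∉ iface e0 → ‖ψ.Dφ i x‖ ≤ Cs) ∧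
        (x ∈ iface e0 → ∀ i,
          |⟪ψ.Dφ i x, e0⟫| + max 0 (-⟪ψ.Dφ i x, e i⟫) ≤ Cs) := by
  have hδ4 : 0 < δ / 4 := by positivity
  set C : ℝ := |lam * Mu + Mℓ| / (δ / 4) with hC
  have hC0 : 0 ≤ C := by positivity
  refine ⟨2 * C + 1, by positivity, fun x hx hxR ψ hmax => ?_⟩
  have key : ∀ i, x ∈ halfPlane e0 (e i) → ∀ v : E3, ‖v‖ = 1 →
      (∃ c0 ci : ℝ, v = c0 • e0 + ci • e i) → (x ∉ iface e0 ∨ 0 ≤ ⟪v, e i⟫) →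
      -⟪ψ.Dφ i x, v⟫ ≤ C := by
    rintro i hi v hv ⟨c0, ci, hvc⟩ hin
    obtain ⟨a, ha, hfa⟩ := hRctrl i x hi hxR ((δ / 4) • v)
      (by rw [norm_smul, hv, Real.norm_of_nonneg hδ4.le]; linarith)
      ⟨δ / 4 * c0, δ / 4 * ci, by rw [hvc, smul_add, smul_smul, smul_smul]⟩
    have hsub := hu x hx ψ hmax i hi a ha (hin.imp_right fun h => by
      rw [hfa, real_inner_smul_left]; exact mul_nonneg hδ4.le h)
    rw [hfa, real_inner_smul_right] at hsub
    have hux : lam * -Mu ≤ lam * u x :=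
      mul_le_mul_of_nonneg_left (abs_le.mp (hMu x hx)).1 hlam.le
    have hl := (abs_le.mp (hlbdd i x hi a ha)).2
    have hK := le_abs_self (lam * Mu + Mℓ)
    rw [hC, le_div_iff₀ hδ4]
    linarith
  refine ⟨fun i hi hxΓ => ?_, fun hxΓ i => ?_⟩
  · by_cases hD : ψ.Dφ i x = 0
    · rw [hD, norm_zero]
      positivity
    have hDn : ‖ψ.Dφ i x‖ ≠ 0 := norm_ne_zero_iff.mpr hD
    obtain ⟨c0, ci, hc⟩ := ψ.dphi_plane i x hi
    have hbound := key i hi (-(‖ψ.Dφ i x‖⁻¹ • ψ.Dφ i x))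
      (by rw [norm_neg, norm_smul, norm_inv, norm_norm, inv_mul_cancel₀ hDn])
      ⟨-(‖ψ.Dφ i x‖⁻¹ * c0), -(‖ψ.Dφ i x‖⁻¹ * ci), by
        generalize ‖ψ.Dφ i x‖⁻¹ = r
        rw [hc]
        module⟩ (Or.inl hxΓ)
    rw [inner_neg_right, neg_neg, real_inner_smul_right, real_inner_self_eq_norm_sq, sq,
      inv_mul_cancel_left₀ hDn] at hbound
    linarith
  · have hi : x ∈ halfPlane e0 (e i) := by
      obtain ⟨t, rfl⟩ := hxΓ
      exact ⟨t, 0, le_rfl, by simp⟩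
    have horth' : ⟪e0, e i⟫ = 0 := by rw [real_inner_comm, horth]
    have hpos := key i hi e0 he0 ⟨1, 0, by simp⟩ (Or.inr horth'.ge)
    have hneg := key i hi (-e0) (by rw [norm_neg, he0]) ⟨-1, 0, by simp⟩
      (Or.inr (by rw [inner_neg_left, horth', neg_zero]))
    have hnormal := key i hi (e i) (he i) ⟨0, 1, by simp⟩ (Or.inr real_inner_self_nonneg)
    rw [inner_neg_right, neg_neg] at hneg
    have htang : |⟪ψ.Dφ i x, e0⟫| ≤ C := abs_le.mpr ⟨by linarith, hneg⟩
    have hmax0 : max 0 (-⟪ψ.Dφ i x, e i⟫) ≤ C := max_le hC0 hnormal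
    linarith
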